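/- Let τ ≥ 1, T = {1,…,2τ}, let M be a perfect matching with parity on T, and let p, q ∈ ℤ^{2τ}. Writing 𝟙 for the all-ones vector, the following expansion holds: Π_{(st,σ) ∈ M} [p,q]_{st,σ} = Σ_{χ ∈ {0,1}^{2τ}} ( Π_{i=1}^{2τ} (χ_i p_i + (1−χ_i) q_i) ) · Π_{(st,σ) ∈ M} [χ, 𝟙−χ]_{st,σ}. -/

import Mathlib

/-- A parity: `odd` or `even`. -/
inductive Par : Type
  | odd : Par
  | even : Par
deriving DecidableEq

/-- The bracket `[p,q]_{st,σ}`: for a parity `σ` and an unordered pair `{s,t}`,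
`[p,q]_{st,odd} = p_s p_t + q_s q_t` and `[p,q]_{st,even} = p_s q_t + q_s p_t`. -/
def brkt {n : ℕ} (p q : Fin n → ℤ) (σ : Par) : Sym2 (Fin n) → ℤ :=
  Sym2.lift ⟨fun s t =>
    match σ with
    | Par.odd => p s * p t + q s * q t
    | Par.even => p s * q t + q s * p t,
    by intro a b; cases σ <;> dsimp only <;> ring⟩

/-- A perfect matching with parity (PMP) on `{0, …, n−1}`: a set of pairs
`(st, σ)` where the unordered pairs `st` are non-degenerate and partition the
index set, and `σ` is a parity. -/
def IsPMP {n : ℕ} (M : Finset (Sym2 (Fin n) × Par)) : Prop :=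
  (∀ x ∈ M, ¬ x.1.IsDiag) ∧ ∀ i : Fin n, ∃! x, x ∈ M ∧ i ∈ x.1

/-- The product `Π_{(st,σ) ∈ M} [p,q]_{st,σ}`. -/
def pmpProd {n : ℕ} (p q : Fin n → ℤ) (M : Finset (Sym2 (Fin n) × Par)) : ℤ :=
  ∏ x ∈ M, brkt p q x.2 x.1

/-- The `{0,1}`-valued indicator of a Boolean, as an integer. -/
def ind : Bool → ℤ := fun b => if b then 1 else 0

theorem brkt_congr {n : ℕ} {p q p' q' : Fin n → ℤ} (σ : Par) {e : Sym2 (Fin n)}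
    (hp : ∀ i ∈ e, p i = p' i) (hq : ∀ i ∈ e, q i = q' i) :
    brkt p q σ e = brkt p' q' σ e := by
  induction e with
  | _ s t =>
    have hs : s ∈ s(s, t) := Sym2.mem_mk_left s t
    have ht : t ∈ s(s, t) := Sym2.mem_mk_right s t
    cases σ <;> simp [brkt, hp s hs, hp t ht, hq s hs, hq t ht]

/-- The bracket of a non-degenerate pair is a linear form in each of its two coordinate pairs. -/
theorem exists_brkt_update {n : ℕ} [DecidableEq (Fin n)] (m : Fin n → ℤ × ℤ) (σ : Par)
    {e : Sym2 (Fin n)} (he : ¬ e.IsDiag) {i : Fin n} (hi : i ∈ e) :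
    ∃ a b : ℤ, ∀ v : ℤ × ℤ,
      brkt (fun j => (Function.update m i v j).1) (fun j => (Function.update m i v j).2) σ e =
        a * v.1 + b * v.2 := by
  obtain ⟨t, rfl⟩ := hi
  have ht : t ≠ i := fun h => he (by simp [h])
  cases σ
  · exact ⟨(m t).1, (m t).2, fun v => by simp [brkt, ht]; ring⟩
  · exact ⟨(m t).2, (m t).1, fun v => by simp [brkt, ht]; ring⟩

/-- The product over a perfect matching is a linear form in each coordinate pair. -/
theorem IsPMP.exists_pmpProd_update {n : ℕ} [DecidableEq (Fin n)]
    {M : Finset (Sym2 (Fin n) × Par)} (hM : IsPMP M) (m : Fin n → ℤ × ℤ) (i : Fin n) :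
    ∃ a b : ℤ, ∀ v : ℤ × ℤ,
      pmpProd (fun j => (Function.update m i v j).1) (fun j => (Function.update m i v j).2) M =
        a * v.1 + b * v.2 := by
  obtain ⟨x, ⟨hxM, hix⟩, huniq⟩ := hM.2 i
  obtain ⟨a, b, hab⟩ := exists_brkt_update m x.2 (hM.1 x hxM) hix
  set c := ∏ y ∈ M.erase x, brkt (fun j => (m j).1) (fun j => (m j).2) y.2 y.1 with hc
  refine ⟨a * c, b * c, fun v => ?_⟩
  have hrest : ∏ y ∈ M.erase x, brkt (fun j => (Function.update m i v j).1)
      (fun j => (Function.update m i v j).2) y.2 y.1 = c := by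
    refine Finset.prod_congr rfl fun y hy => ?_
    obtain ⟨hne, hyM⟩ := Finset.mem_erase.mp hy
    have hji : ∀ j ∈ y.1, j ≠ i := fun j hj h => hne (huniq y ⟨hyM, h ▸ hj⟩)
    exact brkt_congr _ (fun j hj => by simp [hji j hj]) (fun j hj => by simp [hji j hj])
  rw [pmpProd, ← Finset.mul_prod_erase _ _ hxM, hrest, hab]
  ring

/-- The product over a perfect matching, as a multilinear map in the coordinate pairs. -/
def IsPMP.multilinearMap {n : ℕ} {M : Finset (Sym2 (Fin n) × Par)} (hM : IsPMP M) :
    MultilinearMap ℤ (fun _ : Fin n => ℤ × ℤ) ℤ where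
  toFun m := pmpProd (fun i => (m i).1) (fun i => (m i).2) M
  map_update_add' m i v w := by
    obtain ⟨a, b, h⟩ := hM.exists_pmpProd_update m i
    rw [h, h, h, Prod.fst_add, Prod.snd_add]
    ring
  map_update_smul' m i r v := by
    obtain ⟨a, b, h⟩ := hM.exists_pmpProd_update m i
    rw [h, h, Prod.smul_fst, Prod.smul_snd]
    simp only [smul_eq_mul]
    ring

/-- For `τ ≥ 1`, `T = {1,…,2τ}` (encoded as `Fin (2τ)`), a PMP
`M` on `T`, and `p, q ∈ ℤ^{2τ}`:
`Π_{(st,σ) ∈ M} [p,q]_{st,σ}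
  = Σ_{χ ∈ {0,1}^{2τ}} (Π_i (χ_i p_i + (1−χ_i) q_i)) · Π_{(st,σ) ∈ M} [χ, 𝟙−χ]_{st,σ}`,
where vectors `χ ∈ {0,1}^{2τ}` are encoded as functions `Fin (2τ) → Bool`. -/
theorem pmpProd_expansion {τ : ℕ} (hτ : 1 ≤ τ)
    (M : Finset (Sym2 (Fin (2 * τ)) × Par)) (hM : IsPMP M)
    (p q : Fin (2 * τ) → ℤ) :
    pmpProd p q M =
      ∑ χ : Fin (2 * τ) → Bool,
        (∏ i : Fin (2 * τ), (ind (χ i) * p i + (1 - ind (χ i)) * q i)) *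
          pmpProd (fun i => ind (χ i)) (fun i => 1 - ind (χ i)) M := by
  have hdecomp : (fun i => (p i, q i)) = fun i => ∑ b : Bool,
      (ind b * p i + (1 - ind b) * q i) • ((ind b, 1 - ind b) : ℤ × ℤ) := by
    funext i
    simp [ind]
  calc pmpProd p q M = hM.multilinearMap fun i => (p i, q i) := rfl
    _ = _ := by
      rw [hdecomp, MultilinearMap.map_sum]
      refine Finset.sum_congr rfl fun χ _ => ?_
      rw [MultilinearMap.map_smul_univ, smul_eq_mul]
      rfl
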